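/- (Proposition 9) Let x_m be the BayesCG posterior mean computed with the search directions of Proposition 7 (assuming s̃_j ≠ 0 for j ≤ m), and let κ = κ(Σ₀ Aᵀ A) = ‖Σ₀ Aᵀ A‖₂ · ‖(Σ₀ Aᵀ A)⁻¹‖₂ be the 2-norm condition number of Σ₀ Aᵀ A. Then ‖x_m − x*‖_{Σ₀⁻¹} ≤ 2 ((√κ − 1)/(√κ + 1))^m · ‖x₀ − x*‖_{Σ₀⁻¹}. -/

import Mathlib

open Matrix

/-- The `M`-norm `‖v‖_M = √(vᵀ M v)` associated with a symmetric positive definite matrix. -/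
noncomputable def matNorm {d : ℕ} (M : Matrix (Fin d) (Fin d) ℝ) (v : Fin d → ℝ) : ℝ :=
  Real.sqrt (v ⬝ᵥ (M *ᵥ v))

/-- The matrix 2-norm (operator norm induced by the Euclidean vector norm). -/
noncomputable def l2OpNorm {d : ℕ} (M : Matrix (Fin d) (Fin d) ℝ) : ℝ :=
  ‖(Matrix.toEuclideanLin M).toContinuousLinearMap‖

section core
open Polynomial
variable {V : Type*} [NormedAddCommGroup V] [InnerProductSpace ℝ V]

lemma cg_core (T : V →ₗ[ℝ] V) (hT : T.IsSymmetric) (hpos : ∀ v, v ≠ 0 → 0 < inner ℝ v (T v))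
    (m : ℕ) (r s st : ℕ → V)
    (hst1 : st 1 = r 0)
    (hstj : ∀ j, 1 ≤ j → j + 1 ≤ m → st (j+1) = r j - (inner ℝ (s j) (T (r j))) • s j)
    (hs : ∀ j, 1 ≤ j → j ≤ m → s j = (Real.sqrt (inner ℝ (st j) (T (st j))))⁻¹ • st j)
    (hr : ∀ j, j + 1 ≤ m → r (j+1) = r j - (inner ℝ (s (j+1)) (r j)) • T (s (j+1)))
    (hnz : ∀ j, 1 ≤ j → j ≤ m → st j ≠ 0) (j : ℕ) (hj : j ≤ m) :
    (∀ i, 1 ≤ i → i ≤ j → inner ℝ (s i) (r j) = 0) ∧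
    (∀ i, 1 ≤ i → i < j → inner ℝ (s j) (T (s i)) = 0) ∧
    (∀ i, i < j → r i ∈ Submodule.span ℝ (s '' Set.Icc 1 (i+1))) ∧
    (∀ i, 1 ≤ i → i < j → T (s i) ∈ Submodule.span ℝ (s '' Set.Icc 1 (i+1))) ∧
    (∀ i, i < j → inner ℝ (s (i+1)) (r i) ≠ 0) := by
  have hsq : ∀ j, 1 ≤ j → j ≤ m → 0 < Real.sqrt (inner ℝ (st j) (T (st j))) := fun j h1 h2 =>
    Real.sqrt_pos.2 (hpos _ (hnz j h1 h2))
  have hst : ∀ j, 1 ≤ j → j ≤ m → st j = Real.sqrt (inner ℝ (st j) (T (st j))) • s j := by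
    intro j h1 h2
    conv_rhs => rw [hs j h1 h2]
    rw [smul_smul, mul_inv_cancel₀ (hsq j h1 h2).ne', one_smul]
  have hN : ∀ j, 1 ≤ j → j ≤ m → inner ℝ (s j) (T (s j)) = 1 := by
    intro j h1 h2
    have h3 := hsq j h1 h2
    have h4 := Real.sq_sqrt (hpos _ (hnz j h1 h2)).le
    rw [hs j h1 h2]
    rw [map_smul, real_inner_smul_left, real_inner_smul_right]
    field_simp
    linarith
  have hmono : ∀ a b : ℕ, a ≤ b → Submodule.span ℝ (s '' Set.Icc 1 a) ≤ Submodule.span ℝ (s '' Set.Icc 1 b) :=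
    fun a b h => Submodule.span_mono (Set.image_mono (Set.Icc_subset_Icc_right h))
  have hmem : ∀ a b : ℕ, 1 ≤ a → a ≤ b → s a ∈ Submodule.span ℝ (s '' Set.Icc 1 b) :=
    fun a b h1 h2 => Submodule.subset_span ⟨a, ⟨h1, h2⟩, rfl⟩
  induction j with
  | zero => refine ⟨?_, ?_, ?_, ?_, ?_⟩ <;> intros <;> omega
  | succ j ih =>
    obtain ⟨O, C, R, B, al⟩ := ih (by omega)
    have hrj : r j ∈ Submodule.span ℝ (s '' Set.Icc 1 (j+1)) := by
      rcases Nat.eq_zero_or_pos j with rfl | h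
      · rw [← hst1, hst 1 le_rfl hj]
        exact Submodule.smul_mem _ _ (hmem 1 _ le_rfl le_rfl)
      · have : r j = st (j+1) + (inner ℝ (s j) (T (r j))) • s j := by
          rw [hstj j h hj]; abel
        rw [this, hst (j+1) (by omega) hj]
        exact Submodule.add_mem _ (Submodule.smul_mem _ _ (hmem _ _ (by omega) le_rfl))
          (Submodule.smul_mem _ _ (hmem _ _ h (by omega)))
    have R' : ∀ i, i < j + 1 → r i ∈ Submodule.span ℝ (s '' Set.Icc 1 (i+1)) := by
      intro i hi
      rcases Nat.lt_succ_iff_lt_or_eq.1 hi with h | rfl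
      · exact R i h
      · exact hrj
    have hortho : ∀ v ∈ Submodule.span ℝ (s '' Set.Icc 1 j), inner ℝ v (r j) = 0 := by
      intro v hv
      induction hv using Submodule.span_induction with
      | mem x hx => obtain ⟨i, hi, rfl⟩ := hx; exact O i hi.1 hi.2
      | zero => simp
      | add x y _ _ hx hy => rw [inner_add_left, hx, hy, add_zero]
      | smul a x _ hx => rw [real_inner_smul_left, hx, mul_zero]
    have haj : inner ℝ (s (j+1)) (r j) ≠ 0 := by
      have hne : r j ≠ 0 := by
        intro h0
        apply hnz (j+1) (by omega) hj
        rcases Nat.eq_zero_or_pos j with rfl | h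
        · rw [hst1, h0]
        · rw [hstj j h hj, h0]; simp
      have h2 : inner ℝ (st (j+1)) (r j) = inner ℝ (r j) (r j) := by
        rcases Nat.eq_zero_or_pos j with rfl | h
        · rw [hst1]
        · rw [hstj j h hj, inner_sub_left, real_inner_smul_left, O j h le_rfl]; simp
      rw [hs (j+1) (by omega) hj, real_inner_smul_left, h2]
      exact mul_ne_zero (inv_ne_zero (hsq _ (by omega) hj).ne') (inner_self_ne_zero.2 hne)
    have B' : ∀ i, 1 ≤ i → i < j + 1 → T (s i) ∈ Submodule.span ℝ (s '' Set.Icc 1 (i+1)) := by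
      intro i h1 hi
      rcases Nat.lt_succ_iff_lt_or_eq.1 hi with h | rfl
      · exact B i h1 h
      · obtain ⟨k, rfl⟩ : ∃ k, i = k + 1 := ⟨i - 1, by omega⟩
        have ha := al k (by omega)
        have e : T (s (k+1)) = (inner ℝ (s (k+1)) (r k))⁻¹ • (r k - r (k+1)) := by
          rw [hr k (by omega), sub_sub_cancel, smul_smul, inv_mul_cancel₀ ha, one_smul]
        rw [e]
        exact Submodule.smul_mem _ _ (Submodule.sub_mem _ (hmono _ _ (by omega) (R k (by omega))) hrj)
    have C' : ∀ i, 1 ≤ i → i < j + 1 → inner ℝ (s (j+1)) (T (s i)) = 0 := by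
      intro i h1 hi
      suffices hh : inner ℝ (st (j+1)) (T (s i)) = 0 by
        rw [hs (j+1) (by omega) hj, real_inner_smul_left, hh, mul_zero]
      rw [hstj j (by omega) hj, inner_sub_left, real_inner_smul_left]
      rcases Nat.lt_succ_iff_lt_or_eq.1 hi with h | rfl
      · rw [C i h1 h, real_inner_comm, hortho _ (hmono _ _ (by omega) (B i h1 h))]; simp
      · rw [hN i h1 (by omega), ← hT (s i), real_inner_comm]; simp
    refine ⟨?_, C', R', B', ?_⟩
    · intro i h1 hi
      rw [hr j hj, inner_sub_right, real_inner_smul_right]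
      rcases Nat.le_succ_iff.1 hi with h | rfl
      · have := C' i h1 (by omega)
        rw [O i h1 h, ← hT, real_inner_comm (s (j+1)) (T (s i)), this]; simp
      · rw [hN _ (by omega) hj]; simp
    · intro i hi
      rcases Nat.lt_succ_iff_lt_or_eq.1 hi with h | rfl
      · exact al i h
      · exact haj

lemma cg_opt (T : V →ₗ[ℝ] V) (hT : T.IsSymmetric) (hpos : ∀ v, v ≠ 0 → 0 < inner ℝ v (T v))
    (m : ℕ) (r s st : ℕ → V)
    (hst1 : st 1 = r 0)
    (hstj : ∀ j, 1 ≤ j → j + 1 ≤ m → st (j+1) = r j - (inner ℝ (s j) (T (r j))) • s j)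
    (hs : ∀ j, 1 ≤ j → j ≤ m → s j = (Real.sqrt (inner ℝ (st j) (T (st j))))⁻¹ • st j)
    (hr : ∀ j, j + 1 ≤ m → r (j+1) = r j - (inner ℝ (s (j+1)) (r j)) • T (s (j+1)))
    (hnz : ∀ j, 1 ≤ j → j ≤ m → st j ≠ 0)
    (e0 em : V) (he0 : r 0 = T e0) (hem : r m = T em)
    (q : ℝ[X]) (hq0 : q.eval 0 = 1) (hqd : q.natDegree ≤ m) :
    inner ℝ em (T em) ≤ inner ℝ (aeval T q e0) (T (aeval T q e0)) := by
  have core := cg_core T hT hpos m r s st hst1 hstj hs hr hnz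
  have hmono : ∀ a b : ℕ, a ≤ b → Submodule.span ℝ (s '' Set.Icc 1 a) ≤ Submodule.span ℝ (s '' Set.Icc 1 b) :=
    fun a b h => Submodule.span_mono (Set.image_mono (Set.Icc_subset_Icc_right h))
  have hmem : ∀ a b : ℕ, 1 ≤ a → a ≤ b → s a ∈ Submodule.span ℝ (s '' Set.Icc 1 b) :=
    fun a b h1 h2 => Submodule.subset_span ⟨a, ⟨h1, h2⟩, rfl⟩
  have hinj : ∀ v, T v = 0 → v = 0 := by
    intro v hv
    by_contra h
    have := hpos v h
    rw [hv] at this; simp at this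
  obtain ⟨O, _, R, B, _⟩ := core m le_rfl
  have hTK : ∀ i, i < m → ∀ v ∈ Submodule.span ℝ (s '' Set.Icc 1 i),
      T v ∈ Submodule.span ℝ (s '' Set.Icc 1 (i+1)) := by
    intro i hi v hv
    induction hv using Submodule.span_induction with
    | mem x hx => obtain ⟨k, hk, rfl⟩ := hx
                  exact hmono _ _ (by have := hk.2; omega) (B k hk.1 (by have := hk.2; omega))
    | zero => simp
    | add x y _ _ hx hy => rw [map_add]; exact Submodule.add_mem _ hx hy
    | smul a x _ hx => rw [map_smul]; exact Submodule.smul_mem _ _ hx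
  have hpow : ∀ i, i < m → (T ^ i) (r 0) ∈ Submodule.span ℝ (s '' Set.Icc 1 (i+1)) := by
    intro i
    induction i with
    | zero => intro h; simpa using R 0 h
    | succ k ih =>
      intro h
      rw [pow_succ', Module.End.mul_apply]
      exact hTK _ h _ (ih (by omega))
  have hy : ∀ j, j ≤ m → ∃ y ∈ Submodule.span ℝ (s '' Set.Icc 1 m), r j = r 0 - T y := by
    intro j
    induction j with
    | zero => intro _; exact ⟨0, Submodule.zero_mem _, by simp⟩
    | succ k ih =>
      intro h
      obtain ⟨y, hy, e⟩ := ih (by omega)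
      refine ⟨y + (inner ℝ (s (k+1)) (r k)) • s (k+1), Submodule.add_mem _ hy
        (Submodule.smul_mem _ _ (hmem _ _ (by omega) h)), ?_⟩
      rw [hr k h, map_add, map_smul]
      nth_rewrite 1 [e]
      abel
  obtain ⟨y, hyK, hy⟩ := hy m le_rfl
  have hp : aeval T q.divX (r 0) ∈ Submodule.span ℝ (s '' Set.Icc 1 m) := by
    rw [aeval_eq_sum_range, LinearMap.sum_apply]
    refine Submodule.sum_mem _ fun i hi => ?_
    rw [LinearMap.smul_apply]
    by_cases him : i < m
    · exact Submodule.smul_mem _ _ (hmono _ _ him (hpow i him))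
    · rw [coeff_divX, coeff_eq_zero_of_natDegree_lt (by omega), zero_smul]
      exact Submodule.zero_mem _
  have hortho : ∀ v ∈ Submodule.span ℝ (s '' Set.Icc 1 m), inner ℝ v (r m) = 0 := by
    intro v hv
    induction hv using Submodule.span_induction with
    | mem x hx => obtain ⟨i, hi, rfl⟩ := hx; exact O i hi.1 hi.2
    | zero => simp
    | add x y _ _ hx hy => rw [inner_add_left, hx, hy, add_zero]
    | smul a x _ hx => rw [real_inner_smul_left, hx, mul_zero]
  have hcomm : ∀ p : ℝ[X], ∀ v, aeval T p (T v) = T (aeval T p v) := by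
    intro p v
    have h : aeval T (p * X) = aeval T (X * p) := by rw [mul_comm]
    rw [map_mul, map_mul, aeval_X] at h
    exact LinearMap.congr_fun h v
  set z := aeval T q.divX (r 0) + y with hz
  have hq : aeval T q (r 0) = r 0 + T (aeval T q.divX (r 0)) := by
    conv_lhs => rw [← divX_mul_X_add q]
    have : q.coeff 0 = 1 := by rw [coeff_zero_eq_eval_zero, hq0]
    rw [this, map_add, map_mul, aeval_X, LinearMap.add_apply, Module.End.mul_apply, hcomm]
    simp [add_comm]
  have hkey : aeval T q e0 = em + z := by
    have : T (aeval T q e0 - (em + z)) = 0 := by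
      rw [map_sub, map_add, ← hcomm, ← he0, ← hem, hq, hz, hy, map_add]; abel
    exact sub_eq_zero.1 (hinj _ this)
  have hz0 : inner ℝ z (T em) = 0 := by
    rw [← hem]; exact hortho _ (Submodule.add_mem _ hp hyK)
  have hzz : 0 ≤ inner ℝ z (T z) := by
    by_cases h : z = 0
    · simp [h]
    · exact (hpos z h).le
  have hz1 : inner ℝ em (T z) = 0 := by rw [← hT, real_inner_comm, hz0]
  rw [hkey, map_add, inner_add_left, inner_add_right, inner_add_right, hz0, hz1]
  linarith

lemma spec_bound [FiniteDimensional ℝ V] (T : V →ₗ[ℝ] V) (hT : T.IsSymmetric)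
    (hpos : ∀ v, v ≠ 0 → 0 < inner ℝ v (T v)) (q : ℝ[X]) (c : ℝ)
    (hq : ∀ l : ℝ, ∀ v, v ≠ 0 → T v = l • v → |q.eval l| ≤ c) (e : V) :
    inner ℝ (aeval T q e) (T (aeval T q e)) ≤ c ^ 2 * inner ℝ e (T e) := by
  set b := hT.eigenvectorBasis rfl with hb
  set l := hT.eigenvalues rfl with hl
  have hTb : ∀ i, T (b i) = l i • b i := fun i => hT.apply_eigenvectorBasis rfl i
  have hbn : ∀ i, b i ≠ 0 := fun i => b.orthonormal.ne_zero i
  have hl0 : ∀ i, 0 ≤ l i := by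
    intro i
    have := hpos (b i) (hbn i)
    rw [hTb, real_inner_smul_right, real_inner_self_eq_norm_sq, b.orthonormal.1 i] at this
    simp at this; exact this.le
  have hform : ∀ f, inner ℝ f (T f) = ∑ i, l i * (inner ℝ (b i) f) ^ 2 := by
    intro f
    rw [← b.sum_inner_mul_inner]
    refine Finset.sum_congr rfl fun i _ => ?_
    rw [← hT, hTb, real_inner_smul_left, real_inner_comm]; ring
  have hpw : ∀ (i) (f : V), inner ℝ (b i) (aeval T q f) = q.eval (l i) * inner ℝ (b i) f := by
    intro i f
    have hp : ∀ n : ℕ, inner ℝ (b i) ((T ^ n) f) = (l i) ^ n * inner ℝ (b i) f := by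
      intro n
      induction n with
      | zero => simp
      | succ n ih => rw [pow_succ', Module.End.mul_apply, ← hT, hTb, real_inner_smul_left, ih]; ring
    rw [aeval_eq_sum_range, LinearMap.sum_apply, inner_sum, eval_eq_sum_range, Finset.sum_mul]
    refine Finset.sum_congr rfl fun n _ => ?_
    rw [LinearMap.smul_apply, real_inner_smul_right, hp]; ring
  rw [hform, hform, Finset.mul_sum]
  refine Finset.sum_le_sum fun i _ => ?_
  rw [hpw, mul_pow]
  have h1 : q.eval (l i) ^ 2 ≤ c ^ 2 := sq_le_sq' (by linarith [abs_le.1 (hq (l i) _ (hbn i) (hTb i))])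
    (abs_le.1 (hq (l i) _ (hbn i) (hTb i))).2
  have h2 := mul_nonneg (hl0 i) (sq_nonneg (inner ℝ (b i) e))
  nlinarith

lemma cheb_poly (a b : ℝ) (ha : 0 < a) (hab : a ≤ b) (m : ℕ) (hm : 0 < m) :
    ∃ q : ℝ[X], q.eval 0 = 1 ∧ q.natDegree ≤ m ∧ ∀ t, a ≤ t → t ≤ b →
      |q.eval t| ≤ 2 * ((Real.sqrt (b / a) - 1) / (Real.sqrt (b / a) + 1)) ^ m := by
  rcases hab.eq_or_lt with rfl | hlt
  · refine ⟨(1 - C a⁻¹ * X) ^ m, by simp, ?_, ?_⟩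
    · refine natDegree_pow_le.trans ?_
      have : (1 - C a⁻¹ * X : ℝ[X]).natDegree ≤ 1 := by compute_degree
      simpa using Nat.mul_le_mul_left m this
    · intro t h1 h2
      obtain rfl := le_antisymm h1 h2
      simp [ha.ne', hm.ne']
  · set k := Real.sqrt (b / a) with hk
    have hk1 : 1 < k := by rw [hk, Real.lt_sqrt (by norm_num), lt_div_iff₀ ha]; linarith
    have hk2 : k ^ 2 = b / a := Real.sq_sqrt (div_nonneg (by linarith) ha.le)
    have hb : b = k ^ 2 * a := by rw [hk2]; field_simp
    set w := (k + 1) / (k - 1) with hw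
    have hkm : 0 < k - 1 := by linarith
    have hw0 : 0 < w := by positivity
    set th := Real.log w
    have hcosh : Real.cosh th = (b + a) / (b - a) := by
      have h3 : k ^ 2 * a - a ≠ 0 := by rw [← hb]; linarith
      have h4 : k ^ 2 - 1 ≠ 0 := by nlinarith
      rw [Real.cosh_eq, Real.exp_neg, Real.exp_log hw0, hb, hw]
      have : k ^ 2 * a - a = a * (k - 1) * (k + 1) := by ring
      rw [this]
      field_simp
      ring
    have hT : w ^ m / 2 ≤ (Chebyshev.T ℝ m).eval ((b + a) / (b - a)) := by
      rw [← hcosh, Chebyshev.T_real_cosh, Real.cosh_eq]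
      have : Real.exp (((m : ℤ) : ℝ) * th) = w ^ m := by
        rw [Int.cast_natCast, Real.exp_nat_mul, Real.exp_log hw0]
      rw [this]
      have := Real.exp_pos (-(((m : ℤ) : ℝ) * th))
      linarith
    set D := (Chebyshev.T ℝ m).eval ((b + a) / (b - a)) with hD
    have hwm : 0 < w ^ m := by positivity
    have hD0 : 0 < D := by linarith
    have hba : 0 < b - a := by linarith
    refine ⟨C D⁻¹ * (Chebyshev.T ℝ m).comp (C ((b + a) / (b - a)) - C (2 / (b - a)) * X), ?_, ?_, ?_⟩
    · simp [eval_comp, ← hD, hD0.ne']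
    · refine (natDegree_C_mul_le _ _).trans ?_
      refine natDegree_comp_le.trans ?_
      rw [Chebyshev.natDegree_T]
      have : (C ((b + a) / (b - a)) - C (2 / (b - a)) * X : ℝ[X]).natDegree ≤ 1 := by compute_degree
      simpa using Nat.mul_le_mul_left m this
    · intro t h1 h2
      have hx : |(b + a) / (b - a) - 2 / (b - a) * t| ≤ 1 := by
        have : (b + a) / (b - a) - 2 / (b - a) * t = (b + a - 2 * t) / (b - a) := by ring
        rw [this, abs_div, abs_of_pos hba, div_le_one hba, abs_le]
        constructor <;> linarith
      have := Chebyshev.abs_eval_T_real_le_one m hx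
      simp only [eval_mul, eval_C, eval_comp, eval_sub, eval_X]
      rw [abs_mul, abs_of_pos (inv_pos.2 hD0)]
      have h5 : (k - 1) / (k + 1) = w⁻¹ := by rw [hw, inv_div]
      rw [h5, inv_pow]
      calc _ ≤ D⁻¹ * 1 := by gcongr
        _ ≤ (w ^ m / 2)⁻¹ := by rw [mul_one]; gcongr
        _ = _ := by rw [inv_div]; ring
end core

/-- **Proposition 9.** For the BayesCG posterior mean `x_m`, computed with the
search directions of Proposition 7, with `κ = ‖Σ₀ Aᵀ A‖₂ ⬝ ‖(Σ₀ Aᵀ A)⁻¹‖₂` the 2-norm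
condition number of `Σ₀ Aᵀ A`,
`‖x_m − x*‖_{Σ₀⁻¹} ≤ 2 ((√κ − 1)/(√κ + 1))^m ⬝ ‖x₀ − x*‖_{Σ₀⁻¹}`. -/
theorem bayescg_convergence_rate
    (d m : ℕ) (hm : m ≤ d)
    (A : Matrix (Fin d) (Fin d) ℝ) (hA : IsUnit A)
    (b : Fin d → ℝ) (xstar : Fin d → ℝ) (hxstar : xstar = A⁻¹ *ᵥ b)
    (Sigma0 : Matrix (Fin d) (Fin d) ℝ) (hSigma0 : Sigma0.PosDef)
    (x0 : Fin d → ℝ)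
    (x s st r : ℕ → Fin d → ℝ)
    (hx0 : x 0 = x0)
    (hr : ∀ j, j ≤ m → r j = b - A *ᵥ x j)
    (hst1 : st 1 = r 0)
    (hstj : ∀ j, 2 ≤ j → j ≤ m →
      st j = r (j - 1) - (s (j - 1) ⬝ᵥ ((A * Sigma0 * Aᵀ) *ᵥ r (j - 1))) • s (j - 1))
    (hs : ∀ j, 1 ≤ j → j ≤ m →
      s j = (Real.sqrt (st j ⬝ᵥ ((A * Sigma0 * Aᵀ) *ᵥ st j)))⁻¹ • st j)
    (hx : ∀ j, 1 ≤ j → j ≤ m →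
      x j = x (j - 1) + (s j ⬝ᵥ r (j - 1)) • ((Sigma0 * Aᵀ) *ᵥ s j))
    (hnz : ∀ j, 1 ≤ j → j ≤ m → st j ≠ 0)
    (κ : ℝ) (hκ : κ = l2OpNorm (Sigma0 * Aᵀ * A) * l2OpNorm ((Sigma0 * Aᵀ * A)⁻¹)) :
    matNorm Sigma0⁻¹ (x m - xstar) ≤
      2 * ((Real.sqrt κ - 1) / (Real.sqrt κ + 1)) ^ m * matNorm Sigma0⁻¹ (x0 - xstar) := by
  classical
  have hinn : ∀ u v : Fin d → ℝ, inner ℝ (WithLp.toLp 2 u) (WithLp.toLp 2 v) = u ⬝ᵥ v := by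
    intro u v
    rw [EuclideanSpace.inner_toLp_toLp, star_trivial, dotProduct_comm]
  set B := A * Sigma0 * Aᵀ with hB
  have hdA : IsUnit A.det := (Matrix.isUnit_iff_isUnit_det A).1 hA
  have hdAt : IsUnit Aᵀ.det := by rwa [Matrix.det_transpose]
  have hdS : IsUnit Sigma0.det := hSigma0.det_pos.ne'.isUnit
  have hSt : Sigma0ᵀ = Sigma0 := by simpa using hSigma0.isHermitian.eq
  have hBt : B.IsHermitian := by
    change Bᴴ = B
    rw [conjTranspose_eq_transpose_of_trivial, hB, transpose_mul, transpose_mul, transpose_transpose,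
      hSt, Matrix.mul_assoc]
  set T := Matrix.toEuclideanLin B with hTdef
  have hTa : ∀ v : Fin d → ℝ, T (WithLp.toLp 2 v) = WithLp.toLp 2 (B *ᵥ v) :=
    fun v => Matrix.toEuclideanLin_toLp B v
  have hT : T.IsSymmetric := Matrix.isSymmetric_toEuclideanLin_iff.2 hBt
  have hAtinj : ∀ v : Fin d → ℝ, v ≠ 0 → Aᵀ *ᵥ v ≠ 0 := by
    intro v hv h
    apply hv
    rw [← Matrix.one_mulVec v, ← Matrix.nonsing_inv_mul _ hdAt, ← Matrix.mulVec_mulVec, h,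
      Matrix.mulVec_zero]
  have hpos : ∀ v, v ≠ 0 → 0 < inner ℝ v (T v) := by
    intro v hv
    obtain ⟨v, rfl⟩ : ∃ u, v = WithLp.toLp 2 u := ⟨v.ofLp, rfl⟩
    have hv' : v ≠ 0 := by rintro rfl; exact hv rfl
    rw [hTa, hinn]
    have := hSigma0.dotProduct_mulVec_pos (hAtinj v hv')
    rw [star_trivial] at this
    rwa [hB, ← Matrix.mulVec_mulVec, ← Matrix.mulVec_mulVec, dotProduct_mulVec, ← mulVec_transpose]
  let e : ℕ → Fin d → ℝ := fun j => (Aᵀ)⁻¹ *ᵥ (Sigma0⁻¹ *ᵥ (xstar - x j))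
  have hAx : A *ᵥ xstar = b := by
    rw [hxstar, Matrix.mulVec_mulVec, Matrix.mul_nonsing_inv _ hdA, Matrix.one_mulVec]
  have hBe : ∀ j, B *ᵥ e j = A *ᵥ (xstar - x j) := by
    intro j
    simp only [e, hB, Matrix.mulVec_mulVec]
    rw [← Matrix.mul_assoc, Matrix.mul_nonsing_inv_cancel_right _ _ hdAt,
      Matrix.mul_nonsing_inv_cancel_right _ _ hdS]
  have hre : ∀ j, j ≤ m → WithLp.toLp 2 (r j) = T (WithLp.toLp 2 (e j)) := by
    intro j hj
    rw [hTa, hBe, hr j hj, Matrix.mulVec_sub, hAx]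
  have hform : ∀ j, matNorm Sigma0⁻¹ (x j - xstar) =
      Real.sqrt (inner ℝ (WithLp.toLp 2 (e j)) (T (WithLp.toLp 2 (e j)))) := by
    intro j
    rw [hTa, hBe, hinn, matNorm, ← neg_sub xstar, Matrix.mulVec_neg, neg_dotProduct_neg,
      dotProduct_mulVec (e j), ← mulVec_transpose]
    simp only [e]
    rw [Matrix.mulVec_mulVec, Matrix.mul_nonsing_inv _ hdAt, Matrix.one_mulVec, dotProduct_comm]
  rcases Nat.eq_zero_or_pos m with rfl | hmpos
  · rw [hx0, pow_zero]
    have : 0 ≤ matNorm Sigma0⁻¹ (x0 - xstar) := Real.sqrt_nonneg _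
    linarith
  set M := Sigma0 * Aᵀ * A with hM
  have hdM : IsUnit M.det := by
    rw [hM, Matrix.det_mul, Matrix.det_mul]; exact (hdS.mul hdAt).mul hdA
  have hop : ∀ (N : Matrix (Fin d) (Fin d) ℝ) (u : Fin d → ℝ),
      ‖WithLp.toLp 2 (N *ᵥ u)‖ ≤ l2OpNorm N * ‖WithLp.toLp 2 u‖ := by
    intro N u
    exact (Matrix.toEuclideanLin N).toContinuousLinearMap.le_opNorm (WithLp.toLp 2 u)
  have hn0 : ∀ N : Matrix (Fin d) (Fin d) ℝ, 0 ≤ l2OpNorm N := fun N => norm_nonneg _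
  have hnp : ∀ u : Fin d → ℝ, u ≠ 0 → 0 < ‖WithLp.toLp 2 u‖ := by
    intro u hu
    rw [norm_pos_iff]
    intro h
    exact hu (congrArg WithLp.ofLp h)
  have hκ1 : 1 ≤ l2OpNorm M * l2OpNorm M⁻¹ := by
    have hu : (fun _ => 1 : Fin d → ℝ) ≠ 0 := by
      intro h
      have := congrFun h ⟨0, by omega⟩
      simp at this
    set u := (fun _ => 1 : Fin d → ℝ)
    have h1 := hop M (M⁻¹ *ᵥ u)
    have h2 := hop M⁻¹ u
    rw [Matrix.mulVec_mulVec, Matrix.mul_nonsing_inv _ hdM, Matrix.one_mulVec] at h1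
    have h3 := mul_le_mul_of_nonneg_left h2 (hn0 M)
    have h4 := hnp u hu
    by_contra hc
    nlinarith
  have hMi : 0 < l2OpNorm M⁻¹ := by
    rcases (hn0 M⁻¹).eq_or_lt with h | h
    · rw [← h] at hκ1; norm_num at hκ1
    · exact h
  obtain ⟨q, hq0, hqd, hqb⟩ := cheb_poly (l2OpNorm M⁻¹)⁻¹ (l2OpNorm M) (inv_pos.2 hMi)
    (by rw [inv_le_iff_one_le_mul₀ hMi]; exact hκ1) m hmpos
  rw [div_inv_eq_mul, ← hκ] at hqb
  have heig : ∀ l : ℝ, ∀ v, v ≠ 0 → T v = l • v → (l2OpNorm M⁻¹)⁻¹ ≤ l ∧ l ≤ l2OpNorm M := by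
    intro l v hv hl
    have hlp : 0 < l := by
      have := hpos v hv
      rw [hl, real_inner_smul_right] at this
      exact pos_of_mul_pos_left this real_inner_self_nonneg
    obtain ⟨v, rfl⟩ : ∃ u, v = WithLp.toLp 2 u := ⟨v.ofLp, rfl⟩
    have hv' : v ≠ 0 := by rintro rfl; exact hv rfl
    have hl' : B *ᵥ v = l • v := by
      rw [hTa] at hl
      exact congrArg WithLp.ofLp hl
    have hAu : A *ᵥ (A⁻¹ *ᵥ v) = v := by
      rw [Matrix.mulVec_mulVec, Matrix.mul_nonsing_inv _ hdA, Matrix.one_mulVec]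
    set u := A⁻¹ *ᵥ v with hu
    have hu0 : u ≠ 0 := by
      intro h
      rw [h, Matrix.mulVec_zero] at hAu
      exact hv' hAu.symm
    have hMu : M *ᵥ u = l • u := by
      rw [hu, ← Matrix.mulVec_smul, ← hl', hM, hB, Matrix.mulVec_mulVec, Matrix.mulVec_mulVec,
        Matrix.mul_nonsing_inv_cancel_right _ _ hdA, Matrix.mul_assoc A,
        Matrix.nonsing_inv_mul_cancel_left _ _ hdA]
    have hMiu : u = l • (M⁻¹ *ᵥ u) := by
      rw [← Matrix.mulVec_smul, ← hMu, Matrix.mulVec_mulVec, Matrix.nonsing_inv_mul _ hdM,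
        Matrix.one_mulVec]
    have hun := hnp u hu0
    constructor
    · rw [inv_le_iff_one_le_mul₀ hMi]
      have h1 := hop M⁻¹ u
      have h2 : ‖WithLp.toLp 2 u‖ = l * ‖WithLp.toLp 2 (M⁻¹ *ᵥ u)‖ := by
        conv_lhs => rw [hMiu]
        rw [WithLp.toLp_smul, norm_smul, Real.norm_of_nonneg hlp.le]
      have h3 := mul_le_mul_of_nonneg_left h1 hlp.le
      by_contra hc
      nlinarith
    · have h1 := hop M u
      rw [hMu, WithLp.toLp_smul, norm_smul, Real.norm_of_nonneg hlp.le] at h1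
      exact le_of_mul_le_mul_right h1 hun
  set c := 2 * ((Real.sqrt κ - 1) / (Real.sqrt κ + 1)) ^ m with hc
  have hκ1' : 1 ≤ Real.sqrt κ := by
    rw [Real.one_le_sqrt, hκ]; exact hκ1
  have hc0 : 0 ≤ c := by
    have : 0 ≤ Real.sqrt κ - 1 := by linarith
    positivity
  have hopt := cg_opt T hT hpos m (fun j => WithLp.toLp 2 (r j)) (fun j => WithLp.toLp 2 (s j))
    (fun j => WithLp.toLp 2 (st j)) (by simp only [hst1])
    (by
      intro j h1 h2
      have := hstj (j+1) (by omega) h2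
      simp only [Nat.add_sub_cancel] at this
      simp only [hTa, hinn, this, WithLp.toLp_sub, WithLp.toLp_smul])
    (by
      intro j h1 h2
      simp only [hTa, hinn, ← WithLp.toLp_smul]
      rw [← hs j h1 h2])
    (by
      intro j h1
      have := hx (j+1) (by omega) h1
      simp only [Nat.add_sub_cancel] at this
      simp only [hTa, hinn, ← WithLp.toLp_smul, ← WithLp.toLp_sub]
      congr 1
      rw [hr (j+1) h1, this, Matrix.mulVec_add, Matrix.mulVec_smul, Matrix.mulVec_mulVec,
        ← Matrix.mul_assoc, ← hB, ← sub_sub, ← hr j (by omega)])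
    (by
      intro j h1 h2 h
      exact hnz j h1 h2 (congrArg WithLp.ofLp h))
    (WithLp.toLp 2 (e 0)) (WithLp.toLp 2 (e m)) (hre 0 (by omega)) (hre m le_rfl) q hq0 hqd
  have hsp := spec_bound T hT hpos q c
    (fun l v hv hl => hqb l (heig l v hv hl).1 (heig l v hv hl).2) (WithLp.toLp 2 (e 0))
  rw [← hx0, hform, hform]
  calc _ ≤ Real.sqrt (c ^ 2 * inner ℝ (WithLp.toLp 2 (e 0)) (T (WithLp.toLp 2 (e 0)))) :=
        Real.sqrt_le_sqrt (hopt.trans hsp)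
    _ = _ := by rw [Real.sqrt_mul (sq_nonneg c), Real.sqrt_sq hc0]
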